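/- Let N ≥ 2 and let W(x) = k(|x|) be a radially symmetric potential, C¹ away from the origin, with k locally integrable on hypersurfaces and with ω of class C¹ on (0,∞)×(0,∞). Let R > 0 satisfy ω(R,R) = 0 and suppose the shifting stability condition (C2) fails, i.e. ∂₁ω(R,R) + ∂₂ω(R,R) > 0. Then there exists dr₀ > 0 (with dr₀ < R) such that E[δ_{R+dr}] < E[δ_R] for all dr with 0 < |dr| < dr₀. -/

import Mathlib

open MeasureTheory Metric Set Filter
open scoped Topology RealInnerProductSpace

noncomputable section

/-- Euclidean space ℝ^N. -/
abbrev Euc (N : ℕ) := EuclideanSpace ℝ (Fin N)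

/-- The first standard basis vector of ℝ^N. -/
def e1 (N : ℕ) (hN : 0 < N) : Euc N := EuclideanSpace.single ⟨0, hN⟩ 1

/-- σ_N, the surface area of the unit sphere in ℝ^N. -/
def sphereArea (N : ℕ) : ℝ :=
  (μH[(N : ℝ) - 1] (sphere (0 : Euc N) 1)).toReal

/-- ω(r,η) = −(1/σ_N) ∫_{∂B(0,1)} ∇W(r e₁ − η y)·e₁ dσ(y). -/
def omegaFun (N : ℕ) (hN : 0 < N) (W : Euc N → ℝ) (r η : ℝ) : ℝ :=
  -(sphereArea N)⁻¹ *
    ∫ y in sphere (0 : Euc N) 1, ⟪gradient W (r • e1 N hN - η • y), e1 N hN⟫ ∂(μH[(N : ℝ) - 1])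

/-- A radial profile g is locally integrable on hypersurfaces if ∫₀¹ |g(r)| r^{N−2} dr < ∞. -/
def LocIntOnHyp (N : ℕ) (g : ℝ → ℝ) : Prop :=
  IntegrableOn (fun r => |g r| * r ^ (N - 2)) (Ioo (0:ℝ) 1)


/-- The spherical shell of radius R: the uniform probability measure on ∂B(0,R) ⊂ ℝ^N. -/
def shell (N : ℕ) (R : ℝ) : Measure (Euc N) :=
  (μH[(N:ℝ)-1] (sphere (0:Euc N) R))⁻¹ • (μH[(N:ℝ)-1]).restrict (sphere (0:Euc N) R)

/-- The interaction energy E[μ] = (1/2)∬ W(x−y) dμ(x) dμ(y). -/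
def interactionEnergy (N : ℕ) (W : Euc N → ℝ) (μ : Measure (Euc N)) : ℝ :=
  (1/2) * ∫ p : Euc N × Euc N, W (p.1 - p.2) ∂(μ.prod μ)

open scoped ENNReal NNReal Pointwise
open MeasureTheory.Measure Module

/-- Polar coordinates for the Lebesgue integral of a radial function. -/
lemma lintegral_fun_norm_addHaar {E : Type*} [NormedAddCommGroup E] [NormedSpace ℝ E]
    [FiniteDimensional ℝ E] [Nontrivial E] [MeasurableSpace E] [BorelSpace E]
    (μ : Measure E) [μ.IsAddHaarMeasure] {f : ℝ → ℝ≥0∞} (hf : Measurable f) :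
    ∫⁻ x, f ‖x‖ ∂μ = μ.toSphere univ *
      ∫⁻ y in Ioi (0 : ℝ), ENNReal.ofReal (y ^ (finrank ℝ E - 1)) * f y := by
  have h := μ.measurePreserving_homeomorphUnitSphereProd.lintegral_comp
    (f := fun p => f p.2.1) (by fun_prop)
  simp only [homeomorphUnitSphereProd_apply_snd_coe] at h
  have h0 : ∫⁻ x, f ‖x‖ ∂μ = ∫⁻ x in ({0}ᶜ : Set E), f ‖x‖ ∂μ := by rw [restrict_compl_singleton]
  rw [h0, ← lintegral_subtype_comap (measurableSet_singleton _).compl, h,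
    lintegral_prod _ (by fun_prop)]
  simp only [lintegral_const]
  rw [mul_comm, volumeIoiPow, lintegral_withDensity_eq_lintegral_mul _ (by fun_prop) (by fun_prop),
    ← lintegral_subtype_comap measurableSet_Ioi]
  rfl

/-- Near a point of the unit sphere, the distribution of the distance to that point is dominated
by the one given by polar coordinates in the tangent hyperplane. -/
lemma exists_lintegral_sphere_inter_ball_le (N : ℕ) (hN : 2 ≤ N) (e : Euc N) (he : ‖e‖ = 1) :
    ∃ δ > 0, ∃ C : ℝ≥0∞, C ≠ ∞ ∧ ∀ g : ℝ → ℝ≥0∞, Measurable g →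
      ∫⁻ y in sphere (0 : Euc N) 1 ∩ ball e δ, g ‖e - y‖ ∂(μH[(N : ℝ) - 1]) ≤
        C * ∫⁻ s in Ioi (0 : ℝ), ENNReal.ofReal (s ^ (N - 2)) * g s := by
  set F : Submodule ℝ (Euc N) := (Submodule.span ℝ {e})ᗮ with hF
  have hfin : finrank ℝ F = N - 1 := by
    have : Fact (finrank ℝ (Euc N) = (N - 1) + 1) := ⟨by simp; omega⟩
    exact Submodule.finrank_orthogonal_span_singleton (by rintro rfl; simp at he)
  have hcast : (N : ℝ) - 1 = (finrank ℝ F : ℝ) := by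
    rw [hfin, Nat.cast_sub (by omega)]; simp
  have : Nontrivial F := Module.nontrivial_of_finrank_pos (R := ℝ) (by omega)
  have horth : ∀ z : F, ⟪e, (z : Euc N)⟫ = 0 := fun z =>
    Submodule.mem_orthogonal_singleton_iff_inner_right.1 z.2
  let f : F → Euc N := fun z => (1 - ‖z‖ ^ 2 / 2) • e + √(1 - ‖z‖ ^ 2 / 4) • (z : Euc N)
  have hfsm : ContDiffAt ℝ 1 f 0 := by
    have h1 : ContDiffAt ℝ 1 (fun z : F => ‖z‖ ^ 2) 0 := (contDiff_norm_sq ℝ).contDiffAt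
    have h2 : ContDiffAt ℝ 1 (fun z : F => (z : Euc N)) 0 := F.subtypeL.contDiff.contDiffAt
    refine ContDiffAt.add (ContDiffAt.smul (contDiffAt_const.sub (h1.div_const _)) contDiffAt_const)
      (ContDiffAt.smul (ContDiffAt.sqrt (contDiffAt_const.sub (h1.div_const _)) (by simp)) h2)
  obtain ⟨K, t, ht, hK⟩ := hfsm.exists_lipschitzOnWith
  obtain ⟨δ', hδ', hball⟩ := Metric.mem_nhds_iff.1 ht
  set δ := min δ' 1 with hδ
  have hδpos : 0 < δ := lt_min hδ' one_pos
  have hfc : Continuous f := by fun_prop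
  -- the distance from `e` to `f z` is `‖z‖`
  have hdist : ∀ z : F, ‖z‖ < δ → ‖e - f z‖ = ‖z‖ := by
    intro z hz
    have hz1 : ‖z‖ < 1 := hz.trans_le (min_le_right _ _)
    have hs : √(1 - ‖z‖ ^ 2 / 4) ^ 2 = 1 - ‖z‖ ^ 2 / 4 :=
      Real.sq_sqrt (by nlinarith [norm_nonneg z])
    have h : e - f z = (‖z‖ ^ 2 / 2) • e - √(1 - ‖z‖ ^ 2 / 4) • (z : Euc N) := by
      simp only [f]; module
    have h2 : ‖e - f z‖ ^ 2 = ‖z‖ ^ 2 := by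
      rw [h, norm_sub_sq_real, norm_smul, norm_smul, inner_smul_left, inner_smul_right, horth z,
        he, mul_pow, mul_pow, Real.norm_eq_abs, Real.norm_eq_abs, sq_abs, sq_abs, hs,
        Submodule.coe_norm]
      ring
    exact (pow_left_inj₀ (norm_nonneg _) (norm_nonneg _) two_ne_zero).1 h2
  -- the cap is covered by `f`
  have hsurj : ∀ y ∈ sphere (0 : Euc N) 1 ∩ ball e δ, ∃ z : F, ‖z‖ < δ ∧ f z = y := by
    rintro y ⟨hy, hyb⟩
    have hy1 : ‖y‖ = 1 := by simpa using hy
    have hye : ‖y - e‖ < δ := by simpa [dist_eq_norm] using hyb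
    have hye1 : ‖y - e‖ < 1 := hye.trans_le (min_le_right _ _)
    set q := ‖y - e‖ ^ 2 with hq
    have hin : ⟪e, y⟫ = 1 - q / 2 := by
      rw [hq, norm_sub_sq_real, hy1, he, real_inner_comm]; ring
    have hqlt : q < 1 := by nlinarith [norm_nonneg (y - e)]
    have hq0 : 0 < 1 - q / 4 := by linarith
    have hs0 : 0 < √(1 - q / 4) := Real.sqrt_pos.2 hq0
    let w : Euc N := (√(1 - q / 4))⁻¹ • (y - (1 - q / 2) • e)
    have hwF : w ∈ F := by
      rw [hF, Submodule.mem_orthogonal_singleton_iff_inner_right]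
      simp only [w, inner_smul_right, inner_sub_right, hin, real_inner_self_eq_norm_sq, he]
      ring
    have hwn : ‖w‖ ^ 2 = q := by
      have : ‖y - (1 - q / 2) • e‖ ^ 2 = q * (1 - q / 4) := by
        rw [norm_sub_sq_real, inner_smul_right, real_inner_comm, hin, norm_smul, mul_pow, hy1, he,
          Real.norm_eq_abs, sq_abs]
        ring
      simp only [w]
      rw [norm_smul, mul_pow, this, norm_inv, inv_pow, Real.norm_eq_abs, sq_abs,
        Real.sq_sqrt hq0.le, mul_comm q, inv_mul_cancel_left₀ hq0.ne']
    have hwn' : ‖w‖ = ‖y - e‖ :=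
      (pow_left_inj₀ (norm_nonneg _) (norm_nonneg _) two_ne_zero).1 hwn
    refine ⟨⟨w, hwF⟩, by simpa [hwn'] using hye, ?_⟩
    simp only [f, Submodule.coe_norm, hwn, w, smul_smul, mul_inv_cancel₀ hs0.ne', one_smul]
    abel
  have hmeas : (μH[(N : ℝ) - 1] : Measure (Euc N)).restrict (sphere 0 1 ∩ ball e δ) ≤
      ((K : ℝ≥0∞) ^ ((N : ℝ) - 1)) •
        Measure.map f ((μH[(finrank ℝ F : ℝ)] : Measure F).restrict (ball 0 δ)) := by
    refine Measure.le_iff.2 fun A hA => ?_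
    rw [restrict_apply hA, Measure.smul_apply, map_apply hfc.measurable hA,
      restrict_apply (hfc.measurable hA), smul_eq_mul, ← hcast]
    have hsub : f ⁻¹' A ∩ ball 0 δ ⊆ t := fun z hz =>
      hball (ball_subset_ball (min_le_left _ _) hz.2)
    refine le_trans (measure_mono ?_) ((hK.mono hsub).hausdorffMeasure_image_le ?_)
    · rintro y ⟨hyA, hy⟩
      obtain ⟨z, hz, rfl⟩ := hsurj y hy
      exact ⟨z, ⟨hyA, by simpa using hz⟩, rfl⟩
    · rw [hcast]; positivity
  refine ⟨δ, hδpos, (K : ℝ≥0∞) ^ ((N : ℝ) - 1) *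
    (μH[(finrank ℝ F : ℝ)] : Measure F).toSphere univ, ?_, fun g hg => ?_⟩
  · refine ENNReal.mul_ne_top (ENNReal.rpow_ne_top_of_nonneg ?_ ENNReal.coe_ne_top)
      (measure_ne_top _ _)
    rw [hcast]; positivity
  · have hgm : Measurable fun y : Euc N => g ‖e - y‖ := by fun_prop
    calc _ ≤ ∫⁻ y, g ‖e - y‖ ∂(((K : ℝ≥0∞) ^ ((N : ℝ) - 1)) •
          Measure.map f ((μH[(finrank ℝ F : ℝ)] : Measure F).restrict (ball 0 δ))) :=
          lintegral_mono' hmeas le_rfl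
      _ = (K : ℝ≥0∞) ^ ((N : ℝ) - 1) *
          ∫⁻ z in ball (0 : F) δ, g ‖e - f z‖ ∂μH[(finrank ℝ F : ℝ)] := by
          rw [lintegral_smul_measure, lintegral_map hgm hfc.measurable, smul_eq_mul]
      _ = (K : ℝ≥0∞) ^ ((N : ℝ) - 1) * ∫⁻ z in ball (0 : F) δ, g ‖z‖ ∂μH[(finrank ℝ F : ℝ)] := by
          congr 1
          refine setLIntegral_congr_fun measurableSet_ball fun z hz => ?_
          rw [hdist z (by simpa using hz)]
      _ ≤ (K : ℝ≥0∞) ^ ((N : ℝ) - 1) * ∫⁻ z : F, g ‖z‖ ∂μH[(finrank ℝ F : ℝ)] := by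
          gcongr
          exact restrict_le_self
      _ = _ := by
          rw [lintegral_fun_norm_addHaar _ hg, hfin, mul_assoc]
          rfl

/-- The part of the half-strip `(0, ∞) × (0, ε)` at distance `s` from the origin has length at most
`π ε / 2`. -/
lemma lintegral_sqrt_sq_add_sq_le {g : ℝ → ℝ≥0∞} (hg : Measurable g) (n : ℕ) {ε : ℝ}
    (hε : 0 < ε) :
    ∫⁻ d in Ioo 0 ε, ∫⁻ u in Ioi (0 : ℝ), ENNReal.ofReal (u ^ n) * g √(d ^ 2 + u ^ 2) ≤
      ENNReal.ofReal (ε * (Real.pi / 2)) * ∫⁻ s in Ioi (0 : ℝ), ENNReal.ofReal (s ^ n) * g s := by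
  let H : ℝ × ℝ → ℝ≥0∞ := fun p => (Ioi (0 : ℝ) ×ˢ Ioo 0 ε).indicator
    (fun p => ENNReal.ofReal (p.1 ^ n) * g √(p.2 ^ 2 + p.1 ^ 2)) p
  have hH : Measurable H := by
    refine Measurable.indicator (by fun_prop) (measurableSet_Ioi.prod measurableSet_Ioo)
  have h1 : ∫⁻ d in Ioo 0 ε, ∫⁻ u in Ioi (0 : ℝ), ENNReal.ofReal (u ^ n) * g √(d ^ 2 + u ^ 2) =
      ∫⁻ p, H p := by
    rw [lintegral_indicator (measurableSet_Ioi.prod measurableSet_Ioo), volume_eq_prod,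
      ← prod_restrict, lintegral_prod_symm _ (by fun_prop)]
  rw [h1, ← lintegral_comp_polarCoord_symm]
  have h2 : ∀ p ∈ polarCoord.target, ENNReal.ofReal p.1 • H (polarCoord.symm p) ≤
      ENNReal.ofReal p.1 * ((Ioo 0 (ε * (Real.pi / 2) / p.1)).indicator 1 p.2 *
        (ENNReal.ofReal (p.1 ^ n) * g p.1)) := by
    rintro ⟨r, θ⟩ ⟨hr, hθ⟩
    simp only [mem_Ioi] at hr
    rw [smul_eq_mul]
    gcongr
    simp only [H, polarCoord_symm_apply]
    by_cases hmem : (r * Real.cos θ, r * Real.sin θ) ∈ Ioi (0 : ℝ) ×ˢ Ioo 0 ε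
    · rw [indicator_of_mem hmem]
      obtain ⟨hc, hs0, hsε⟩ := hmem
      simp only [mem_Ioi] at hc hs0 hsε
      have hc' : 0 < Real.cos θ := pos_of_mul_pos_right hc hr.le
      have hs' : 0 < Real.sin θ := pos_of_mul_pos_right hs0 hr.le
      have hθ0 : 0 < θ := by
        by_contra! h
        exact absurd (Real.sin_nonpos_of_nonpos_of_neg_pi_le h hθ.1.le) hs'.not_ge
      have hθ1 : θ < Real.pi / 2 := by
        by_contra! h
        exact absurd (Real.cos_nonpos_of_pi_div_two_le_of_le h (by linarith [hθ.2, Real.pi_pos]))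
          hc'.not_ge
      have hJ := Real.mul_le_sin hθ0.le hθ1.le
      have hmem2 : θ ∈ Ioo 0 (ε * (Real.pi / 2) / r) := by
        refine ⟨hθ0, ?_⟩
        rw [lt_div_iff₀ hr]
        have h3 : r * (2 / Real.pi * θ) < ε := lt_of_le_of_lt (by gcongr) hsε
        have h4 : θ * r = r * (2 / Real.pi * θ) * (Real.pi / 2) := by field_simp
        rw [h4]
        have := Real.pi_pos
        gcongr
      rw [indicator_of_mem hmem2, Pi.one_apply, one_mul]
      have h5 : √((r * Real.sin θ) ^ 2 + (r * Real.cos θ) ^ 2) = r := by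
        rw [mul_pow, mul_pow, ← mul_add, Real.sin_sq_add_cos_sq, mul_one, Real.sqrt_sq hr.le]
      rw [h5]
      gcongr
      nlinarith [Real.cos_le_one θ]
    · rw [indicator_of_notMem hmem]; exact zero_le
  refine (setLIntegral_mono' polarCoord.open_target.measurableSet h2).trans ?_
  have hmi : Measurable fun p : ℝ × ℝ =>
      (Ioo 0 (ε * (Real.pi / 2) / p.1)).indicator (1 : ℝ → ℝ≥0∞) p.2 := by
    have : MeasurableSet {p : ℝ × ℝ | 0 < p.2 ∧ p.2 < ε * (Real.pi / 2) / p.1} :=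
      (measurableSet_lt measurable_const measurable_snd).inter
        (measurableSet_lt measurable_snd (by fun_prop))
    exact measurable_one.indicator this
  rw [polarCoord_target, volume_eq_prod, ← prod_restrict, lintegral_prod _ (by fun_prop),
    ← lintegral_const_mul _ (by fun_prop)]
  refine setLIntegral_mono' measurableSet_Ioi fun r hr => ?_
  simp only [mem_Ioi] at hr
  have h7 : Measurable ((Ioo 0 (ε * (Real.pi / 2) / r)).indicator (1 : ℝ → ℝ≥0∞)) :=
    measurable_one.indicator measurableSet_Ioo
  dsimp only
  rw [lintegral_const_mul _ (h7.mul_const _), lintegral_mul_const _ h7]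
  have h6 : ∫⁻ θ in Ioo (-Real.pi) Real.pi,
      (Ioo 0 (ε * (Real.pi / 2) / r)).indicator (1 : ℝ → ℝ≥0∞) θ ≤
      ENNReal.ofReal (ε * (Real.pi / 2) / r) := by
    refine (lintegral_mono' restrict_le_self le_rfl).trans ?_
    rw [lintegral_indicator_one measurableSet_Ioo]
    simp
  calc _ ≤ ENNReal.ofReal r * (ENNReal.ofReal (ε * (Real.pi / 2) / r) *
        (ENNReal.ofReal (r ^ n) * g r)) := by
        gcongr
    _ = _ := by
        rw [← mul_assoc, ← ENNReal.ofReal_mul hr.le]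
        congr 2
        field_simp

lemma lintegral_Ioi_pow_mul_comp_mul {g : ℝ → ℝ≥0∞} (hg : Measurable g) (n : ℕ) {ρ : ℝ}
    (hρ : 0 < ρ) :
    ∫⁻ s in Ioi (0 : ℝ), ENNReal.ofReal (s ^ n) * g (ρ * s) =
      ENNReal.ofReal ((ρ ^ (n + 1))⁻¹) * ∫⁻ s in Ioi (0 : ℝ), ENNReal.ofReal (s ^ n) * g s := by
  let H : ℝ → ℝ≥0∞ := (Ioi (0 : ℝ)).indicator fun s => ENNReal.ofReal (s ^ n) * g s
  have hH : Measurable H := Measurable.indicator (by fun_prop) measurableSet_Ioi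
  have h1 : ∀ s : ℝ, (Ioi (0 : ℝ)).indicator (fun s => ENNReal.ofReal (s ^ n) * g (ρ * s)) s =
      ENNReal.ofReal ((ρ ^ n)⁻¹) * H (ρ * s) := by
    intro s
    by_cases hs : 0 < s
    · have hs' : 0 < ρ * s := mul_pos hρ hs
      simp only [H, indicator_of_mem (mem_Ioi.2 hs), indicator_of_mem (mem_Ioi.2 hs')]
      rw [← mul_assoc, ← ENNReal.ofReal_mul (by positivity)]
      congr 2
      field_simp
      ring
    · have hs' : ¬ 0 < ρ * s := by
        simpa [hρ] using hs
      simp [H, hs, hs']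
  have h2 : ∫⁻ s, H (ρ * s) = ENNReal.ofReal ρ⁻¹ * ∫⁻ s, H s := by
    rw [← lintegral_map hH (by fun_prop), Real.map_volume_mul_left hρ.ne', lintegral_smul_measure,
      abs_of_pos (inv_pos.2 hρ), smul_eq_mul]
  rw [← lintegral_indicator measurableSet_Ioi, lintegral_congr h1,
    lintegral_const_mul _ (by fun_prop), h2, ← mul_assoc, ← ENNReal.ofReal_mul (by positivity),
    lintegral_indicator measurableSet_Ioi]
  congr 2
  field_simp
  ring

lemma integrable_of_continuous_of_ae_mem_Icc {μ : Measure ℝ} [IsFiniteMeasure μ]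
    {a b : ℝ} (hμ : ∀ᵐ x ∂μ, x ∈ Icc a b) {f : ℝ → ℝ} (hf : Continuous f) : Integrable f μ := by
  obtain ⟨M, hM⟩ := isCompact_Icc.exists_bound_of_continuousOn (hf.continuousOn (s := Icc a b))
  exact Integrable.of_bound hf.aestronglyMeasurable M (hμ.mono hM)

lemma exists_continuous_enorm_sub_le {K : ℝ → ℝ} {n : ℕ} (hK : ContinuousOn K {0}ᶜ)
    (hKint : IntegrableOn (fun r => |K r| * r ^ n) (Ioo (0 : ℝ) 1)) {δ τ : ℝ} (hδ : 0 < δ)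
    (hτ : 0 < τ) :
    ∃ (f : ℝ → ℝ) (g : ℝ → ℝ≥0∞), Continuous f ∧ Measurable g ∧ (∀ s, ‖K s - f s‖ₑ ≤ g s) ∧
      (∀ s, δ ≤ s → g s = 0) ∧
      ∫⁻ s in Ioi (0 : ℝ), ENNReal.ofReal (s ^ n) * g s ≤ ENNReal.ofReal τ := by
  have hKm : Measurable K := measurable_of_continuousOn_compl_singleton 0 hK
  -- the integral over short intervals is small
  have hfin : ∫⁻ s in Ioo (0 : ℝ) 1, ENNReal.ofReal (s ^ n) * ‖K s‖ₑ ≠ ∞ := by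
    refine ne_of_eq_of_ne ?_ hKint.2.ne
    refine setLIntegral_congr_fun measurableSet_Ioo fun s hs => ?_
    have : 0 ≤ s ^ n := pow_nonneg hs.1.le _
    rw [mul_comm, enorm_mul, Real.enorm_of_nonneg this, Real.enorm_eq_ofReal_abs,
      Real.enorm_eq_ofReal_abs, abs_abs]
  have hlim : Tendsto (fun η : ℝ => ∫⁻ s in Ioo (0 : ℝ) η, ENNReal.ofReal (s ^ n) * ‖K s‖ₑ
      ∂(volume.restrict (Ioo (0 : ℝ) 1))) (𝓝[>] 0) (𝓝 0) := by
    refine tendsto_setLIntegral_zero hfin ?_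
    have h0 : Tendsto (fun η : ℝ => ENNReal.ofReal η) (𝓝[>] 0) (𝓝 0) := by
      simpa using (ENNReal.continuous_ofReal.tendsto 0).mono_left nhdsWithin_le_nhds
    refine tendsto_of_tendsto_of_tendsto_of_le_of_le tendsto_const_nhds h0 (fun _ => zero_le) ?_
    intro η
    refine (restrict_le_self _).trans ?_
    simp
  have hev := (hlim.eventually_le_const (ENNReal.ofReal_pos.2 hτ)).and
    (Ioo_mem_nhdsGT (lt_min hδ one_pos))
  obtain ⟨η, hη, hη0, hη1⟩ := hev.exists
  have hηδ : η ≤ δ := hη1.le.trans (min_le_left _ _)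
  have hη1' : η ≤ 1 := hη1.le.trans (min_le_right _ _)
  let χ : ℝ → ℝ := fun s => max 0 (min 1 (2 * s / η - 1))
  have hχc : Continuous χ := by fun_prop
  have hχ0 : ∀ s, 0 ≤ χ s := fun s => le_max_left _ _
  have hχ1 : ∀ s, χ s ≤ 1 := fun s => max_le zero_le_one (min_le_left _ _)
  have hχη : ∀ s, η ≤ s → χ s = 1 := by
    intro s hs
    have : 1 ≤ 2 * s / η - 1 := by
      rw [le_sub_iff_add_le, le_div_iff₀ hη0]; linarith
    simp [χ, this]
  have hχz : ∀ s, s < η / 2 → χ s = 0 := by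
    intro s hs
    have : 2 * s / η - 1 ≤ 0 := by
      rw [sub_nonpos, div_le_one hη0]; linarith
    exact max_eq_left ((min_le_right _ _).trans this)
  refine ⟨fun s => χ s * K s, (Iio η).indicator fun s => ‖K s‖ₑ, ?_, ?_, ?_, ?_, ?_⟩
  · rw [continuous_iff_continuousAt]
    intro s
    by_cases hs : s = 0
    · subst hs
      have : (fun s => χ s * K s) =ᶠ[𝓝 0] fun _ => 0 := by
        filter_upwards [Iio_mem_nhds (half_pos hη0)] with s hs
        rw [hχz s hs, zero_mul]
      exact continuousAt_const.congr this.symm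
    · exact hχc.continuousAt.mul (hK.continuousAt (isOpen_compl_singleton.mem_nhds hs))
  · exact Measurable.indicator (by fun_prop) measurableSet_Iio
  · intro s
    by_cases hs : s < η
    · rw [indicator_of_mem (mem_Iio.2 hs), show K s - χ s * K s = (1 - χ s) * K s by ring,
        enorm_mul]
      refine mul_le_of_le_one_left zero_le ?_
      rw [Real.enorm_of_nonneg (by linarith [hχ1 s]), ENNReal.ofReal_le_one]
      linarith [hχ0 s]
    · simp only [hχη s (not_lt.1 hs)]; simp
  · intro s hs
    exact indicator_of_notMem (by simpa using hηδ.trans hs) _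
  · rw [Measure.restrict_restrict measurableSet_Ioo,
      inter_eq_left.2 (Ioo_subset_Ioo_right hη1')] at hη
    refine le_of_eq_of_le ?_ hη
    rw [← lintegral_indicator measurableSet_Ioi, ← lintegral_indicator measurableSet_Ioo]
    refine lintegral_congr fun s => ?_
    by_cases h0 : 0 < s <;> by_cases h1 : s < η <;> simp [h0, h1, indicator]

/-- A measure on the line carried by `[0, 2]` whose density near `0` is at most a multiple of
`s ^ n`. -/
structure HasPowBoundNearZero (μ : Measure ℝ) (n : ℕ) (δ : ℝ) (C : ℝ≥0∞) : Prop where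
  pos : 0 < δ
  ne_top : C ≠ ∞
  ae_mem : ∀ᵐ x ∂μ, x ∈ Icc (0 : ℝ) 2
  le : ∀ g : ℝ → ℝ≥0∞, Measurable g →
    ∫⁻ x in Iio δ, g x ∂μ ≤ C * ∫⁻ s in Ioi (0 : ℝ), ENNReal.ofReal (s ^ n) * g s

namespace HasPowBoundNearZero

variable {μ : Measure ℝ} {n : ℕ} {δ : ℝ} {C : ℝ≥0∞}

lemma lintegral_comp_mul_le (h : HasPowBoundNearZero μ n δ C) {ρ : ℝ} (hρ : 0 < ρ)
    {g : ℝ → ℝ≥0∞} (hg : Measurable g) (hg0 : ∀ s, ρ * δ ≤ s → g s = 0) :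
    ∫⁻ x, g (ρ * x) ∂μ ≤ C * ENNReal.ofReal ((ρ ^ (n + 1))⁻¹) *
      ∫⁻ s in Ioi (0 : ℝ), ENNReal.ofReal (s ^ n) * g s := by
  have h1 : ∫⁻ x, g (ρ * x) ∂μ = ∫⁻ x in Iio δ, g (ρ * x) ∂μ := by
    rw [← lintegral_indicator measurableSet_Iio]
    refine lintegral_congr fun x => ?_
    by_cases hx : x < δ
    · rw [indicator_of_mem (mem_Iio.2 hx)]
    · rw [indicator_of_notMem (by simpa using hx)]
      exact hg0 _ (by have := not_lt.1 hx; gcongr)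
  rw [h1, mul_assoc, ← lintegral_Ioi_pow_mul_comp_mul hg n hρ]
  exact h.le _ (by fun_prop)

lemma exists_forall_lintegral_le (h : HasPowBoundNearZero μ n δ C) {ρ : ℝ} (hρ : 0 < ρ) :
    ∃ A : ℝ, 0 ≤ A ∧ ∀ (g : ℝ → ℝ≥0∞) (τ : ℝ), Measurable g → (∀ s, ρ * δ ≤ s → g s = 0) →
      ∫⁻ s in Ioi (0 : ℝ), ENNReal.ofReal (s ^ n) * g s ≤ ENNReal.ofReal τ →
      ∫⁻ x, g (ρ * x) ∂μ ≤ ENNReal.ofReal (A * τ) ∧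
      ∀ ε > 0, ∫⁻ d in Ioo 0 ε, ∫⁻ x, g √(d ^ 2 + (ρ * x) ^ 2) ∂μ ≤
        ENNReal.ofReal ε * ENNReal.ofReal (A * τ) := by
  set D : ℝ≥0∞ := C * ENNReal.ofReal ((ρ ^ (n + 1))⁻¹) with hD
  have hDtop : D ≠ ∞ := ENNReal.mul_ne_top h.ne_top ENNReal.ofReal_ne_top
  have hpi : (1 : ℝ) ≤ Real.pi / 2 := Real.one_le_pi_div_two
  refine ⟨D.toReal * (Real.pi / 2), by positivity, fun g τ hg hg0 hgτ => ⟨?_, fun ε hε => ?_⟩⟩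
  · calc _ ≤ D * ENNReal.ofReal τ := (h.lintegral_comp_mul_le hρ hg hg0).trans (by gcongr)
      _ = ENNReal.ofReal (D.toReal) * 1 * ENNReal.ofReal τ := by
        rw [ENNReal.ofReal_toReal hDtop, mul_one]
      _ ≤ ENNReal.ofReal (D.toReal) * ENNReal.ofReal (Real.pi / 2) * ENNReal.ofReal τ := by
        gcongr; exact ENNReal.one_le_ofReal.2 hpi
      _ = _ := by
        rw [ENNReal.ofReal_mul (by positivity), ENNReal.ofReal_mul (by positivity)]
  · have h1 : ∀ d : ℝ, ∫⁻ x, g √(d ^ 2 + (ρ * x) ^ 2) ∂μ ≤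
        D * ∫⁻ s in Ioi (0 : ℝ), ENNReal.ofReal (s ^ n) * g √(d ^ 2 + s ^ 2) := fun d => by
      refine h.lintegral_comp_mul_le (g := fun s => g √(d ^ 2 + s ^ 2)) hρ (by fun_prop) ?_
      intro s hs
      refine hg0 _ (hs.trans (Real.le_sqrt_of_sq_le ?_))
      nlinarith [sq_nonneg d]
    calc _ ≤ ∫⁻ d in Ioo 0 ε, D * ∫⁻ s in Ioi (0 : ℝ), ENNReal.ofReal (s ^ n) *
          g √(d ^ 2 + s ^ 2) := lintegral_mono h1
      _ = D * ∫⁻ d in Ioo 0 ε, ∫⁻ s in Ioi (0 : ℝ), ENNReal.ofReal (s ^ n) *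
          g √(d ^ 2 + s ^ 2) := lintegral_const_mul' _ _ hDtop
      _ ≤ D * (ENNReal.ofReal (ε * (Real.pi / 2)) * ENNReal.ofReal τ) := by
        gcongr
        exact (lintegral_sqrt_sq_add_sq_le hg n hε).trans (by gcongr)
      _ = ENNReal.ofReal D.toReal * (ENNReal.ofReal (ε * (Real.pi / 2)) * ENNReal.ofReal τ) := by
        rw [ENNReal.ofReal_toReal hDtop]
      _ = _ := by
        rw [ENNReal.ofReal_mul hε.le, ENNReal.ofReal_mul (by positivity),
          ENNReal.ofReal_mul (by positivity)]
        ring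

lemma integrable_comp_mul [IsFiniteMeasure μ] (h : HasPowBoundNearZero μ n δ C) {K : ℝ → ℝ}
    (hK : ContinuousOn K {0}ᶜ) (hKint : IntegrableOn (fun r => |K r| * r ^ n) (Ioo (0 : ℝ) 1))
    {ρ : ℝ} (hρ : 0 < ρ) : Integrable (fun x => K (ρ * x)) μ := by
  have hKm : Measurable K := measurable_of_continuousOn_compl_singleton 0 hK
  obtain ⟨f, g, hf, hg, hKf, hg0, hgτ⟩ :=
    exists_continuous_enorm_sub_le hK hKint (mul_pos hρ h.pos) one_pos
  obtain ⟨A, -, hA⟩ := h.exists_forall_lintegral_le hρ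
  have h1 : Integrable (fun x => f (ρ * x)) μ :=
    integrable_of_continuous_of_ae_mem_Icc h.ae_mem (by fun_prop)
  have h2 : Integrable (fun x => K (ρ * x) - f (ρ * x)) μ := by
    have := hf.measurable
    refine ⟨by fun_prop, lt_of_le_of_lt (lintegral_mono fun x => hKf _) ?_⟩
    exact (hA g 1 hg hg0 hgτ).1.trans_lt ENNReal.ofReal_lt_top
  exact (h1.add h2).congr (.of_forall fun x => by simp)

/-- Inequalities between regularised energies pass to the limit. Individual regularised energies
need not converge, but their averages do. -/
lemma integral_sub_integral_le [IsFiniteMeasure μ] (h : HasPowBoundNearZero μ n δ C) {K : ℝ → ℝ}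
    (hK : ContinuousOn K {0}ᶜ) (hKint : IntegrableOn (fun r => |K r| * r ^ n) (Ioo (0 : ℝ) 1))
    {ρ₁ ρ₂ a : ℝ} (hρ₁ : 0 < ρ₁) (hρ₂ : 0 < ρ₂)
    (ha : ∀ᶠ d in 𝓝[>] (0 : ℝ), ∫ x, K √(d ^ 2 + (ρ₂ * x) ^ 2) ∂μ -
      ∫ x, K √(d ^ 2 + (ρ₁ * x) ^ 2) ∂μ ≤ a) :
    ∫ x, K (ρ₂ * x) ∂μ - ∫ x, K (ρ₁ * x) ∂μ ≤ a := by
  obtain ⟨A₁, hA₁0, hA₁⟩ := h.exists_forall_lintegral_le hρ₁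
  obtain ⟨A₂, hA₂0, hA₂⟩ := h.exists_forall_lintegral_le hρ₂
  refine le_of_forall_pos_le_add fun η hη => ?_
  by_contra! hcon
  set τ : ℝ := η / (2 * (A₁ + A₂) + 2) with hτdef
  have hτ : 0 < τ := by positivity
  obtain ⟨f, g, hf, hg, hKf, hg0, hgτ⟩ :=
    exists_continuous_enorm_sub_le hK hKint (mul_pos (lt_min hρ₁ hρ₂) h.pos) hτ
  have hδ := h.pos
  have hfm := hf.measurable
  specialize hA₁ g τ hg (fun s hs => hg0 s (le_trans (by gcongr; exact min_le_left _ _) hs)) hgτ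
  specialize hA₂ g τ hg (fun s hs => hg0 s (le_trans (by gcongr; exact min_le_right _ _) hs)) hgτ
  have hbase : ∀ ρ > 0, ∀ A : ℝ, 0 ≤ A → ∫⁻ x, g (ρ * x) ∂μ ≤ ENNReal.ofReal (A * τ) →
      |∫ x, K (ρ * x) ∂μ - ∫ x, f (ρ * x) ∂μ| ≤ A * τ := by
    intro ρ hρ A hA0 hA
    rw [← integral_sub (h.integrable_comp_mul hK hKint hρ)
      (integrable_of_continuous_of_ae_mem_Icc h.ae_mem (by fun_prop))]
    have h1 := (enorm_integral_le_lintegral_enorm (μ := μ)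
      fun x => K (ρ * x) - f (ρ * x)).trans ((lintegral_mono fun x => hKf (ρ * x)).trans hA)
    rwa [← ofReal_norm, ENNReal.ofReal_le_ofReal_iff (by positivity),
      Real.norm_eq_abs] at h1
  have hb₁ := abs_le.1 (hbase ρ₁ hρ₁ A₁ hA₁0 hA₁.1)
  have hb₂ := abs_le.1 (hbase ρ₂ hρ₂ A₂ hA₂0 hA₂.1)
  have hlim : ∀ ρ > 0, Tendsto (fun d : ℝ => ∫ x, f √(d ^ 2 + (ρ * x) ^ 2) ∂μ) (𝓝[>] 0)
      (𝓝 (∫ x, f (ρ * x) ∂μ)) := by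
    intro ρ hρ
    obtain ⟨M, hM⟩ := (isCompact_Icc (a := (0 : ℝ)) (b := 1 + ρ * 2)).exists_bound_of_continuousOn
      hf.continuousOn
    refine tendsto_integral_filter_of_dominated_convergence (fun _ => M)
      (.of_forall fun d => by fun_prop) ?_ (integrable_const _) ?_
    · filter_upwards [Ioo_mem_nhdsGT (zero_lt_one (α := ℝ))] with d hd
      filter_upwards [h.ae_mem] with x hx
      refine hM _ ⟨Real.sqrt_nonneg _, Real.sqrt_le_iff.2 ⟨by positivity, ?_⟩⟩
      have h1 : 0 ≤ ρ * x := mul_nonneg hρ.le hx.1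
      have h2 : ρ * x ≤ ρ * 2 := by gcongr; exact hx.2
      nlinarith [hd.1, hd.2]
    · filter_upwards [h.ae_mem] with x hx
      have hc : Continuous fun d : ℝ => f √(d ^ 2 + (ρ * x) ^ 2) := by fun_prop
      have := (hc.tendsto 0).mono_left (nhdsWithin_le_nhds (s := Ioi 0))
      simpa [Real.sqrt_sq (mul_nonneg hρ.le hx.1)] using this
  have hsub := (hlim ρ₂ hρ₂).sub (hlim ρ₁ hρ₁)
  have hev := hsub.eventually_const_lt (sub_lt_self _ hτ)
  obtain ⟨ε, hε, hεsub⟩ := mem_nhdsGT_iff_exists_Ioo_subset.1 (ha.and hev)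
  simp only [mem_Ioi] at hε
  have hreg : ∀ d > 0, ∀ ρ : ℝ, ‖∫ x, K √(d ^ 2 + (ρ * x) ^ 2) ∂μ -
      ∫ x, f √(d ^ 2 + (ρ * x) ^ 2) ∂μ‖ₑ ≤ ∫⁻ x, g √(d ^ 2 + (ρ * x) ^ 2) ∂μ := by
    intro d hd ρ
    have hKc : Continuous fun x : ℝ => K √(d ^ 2 + (ρ * x) ^ 2) := by
      refine hK.comp_continuous (by fun_prop) fun x => ?_
      exact (Real.sqrt_pos.2 (by positivity)).ne'
    rw [← integral_sub (integrable_of_continuous_of_ae_mem_Icc h.ae_mem hKc)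
      (integrable_of_continuous_of_ae_mem_Icc h.ae_mem (by fun_prop))]
    exact (enorm_integral_le_lintegral_enorm _).trans (lintegral_mono fun x => hKf _)
  set b : ℝ := η - (A₁ + A₂) * τ - τ with hb
  have hpt : ∀ d ∈ Ioo 0 ε, ENNReal.ofReal b ≤
      ∫⁻ x, g √(d ^ 2 + (ρ₂ * x) ^ 2) ∂μ + ∫⁻ x, g √(d ^ 2 + (ρ₁ * x) ^ 2) ∂μ := by
    intro d hd
    obtain ⟨h1, h2⟩ := hεsub hd
    refine le_trans ?_ (add_le_add (hreg d hd.1 ρ₂) (hreg d hd.1 ρ₁))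
    refine le_trans ?_ (enorm_sub_le)
    rw [← ofReal_norm, Real.norm_eq_abs]
    refine ENNReal.ofReal_le_ofReal (le_trans ?_ (neg_le_abs _))
    linarith [hb₁.1, hb₂.2]
  have hgm : ∀ ρ : ℝ, Measurable fun d : ℝ => ∫⁻ x, g √(d ^ 2 + (ρ * x) ^ 2) ∂μ := fun ρ =>
    Measurable.lintegral_prod_right' (f := fun p : ℝ × ℝ => g √(p.1 ^ 2 + (ρ * p.2) ^ 2))
      (by fun_prop)
  have hint : ENNReal.ofReal b * ENNReal.ofReal ε ≤
      ENNReal.ofReal ε * ENNReal.ofReal (A₂ * τ) + ENNReal.ofReal ε * ENNReal.ofReal (A₁ * τ) := by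
    calc _ = ∫⁻ d in Ioo 0 ε, ENNReal.ofReal b := by simp
      _ ≤ _ := setLIntegral_mono' measurableSet_Ioo hpt
      _ = _ := lintegral_add_left (hgm ρ₂) _
      _ ≤ _ := add_le_add (hA₂.2 ε hε) (hA₁.2 ε hε)
  rw [← mul_add, mul_comm, ← ENNReal.ofReal_add (by positivity) (by positivity),
    ENNReal.mul_le_mul_iff_right (ENNReal.ofReal_pos.2 hε).ne' ENNReal.ofReal_ne_top,
    ENNReal.ofReal_le_ofReal_iff (by positivity)] at hint
  have hητ : η = (2 * (A₁ + A₂) + 2) * τ := by rw [hτdef]; field_simp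
  nlinarith

end HasPowBoundNearZero

lemma norm_e1 (N : ℕ) (hN : 0 < N) : ‖e1 N hN‖ = 1 := by simp [e1]

lemma map_smul_shell (N : ℕ) (hN : 1 ≤ N) {ρ : ℝ} (hρ : 0 < ρ) :
    (shell N 1).map (fun x => ρ • x) = shell N ρ := by
  have hd : (0 : ℝ) ≤ (N : ℝ) - 1 := by
    rw [sub_nonneg]; exact_mod_cast hN
  have hS : sphere (0 : Euc N) ρ = ρ • sphere (0 : Euc N) 1 := by
    rw [smul_sphere' hρ.ne']; simp [abs_of_pos hρ]
  have ht : ((‖ρ‖₊ ^ ((N : ℝ) - 1) : ℝ≥0) : ℝ≥0∞) ≠ 0 := by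
    exact ENNReal.coe_ne_zero.2 (NNReal.rpow_pos (nnnorm_pos.2 hρ.ne')).ne'
  ext A hA
  have hinter : A ∩ ρ • sphere (0 : Euc N) 1 =
      ρ • ((fun x => ρ • x) ⁻¹' A ∩ sphere (0 : Euc N) 1) := by
    rw [smul_set_inter₀ hρ.ne']
    congr 1
    ext x
    simp [mem_smul_set_iff_inv_smul_mem₀ hρ.ne', hρ.ne']
  rw [map_apply (by fun_prop) hA, shell, shell, Measure.smul_apply, Measure.smul_apply,
    restrict_apply hA, restrict_apply (measurable_const_smul ρ hA), hS, hinter,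
    hausdorffMeasure_smul₀ hd hρ.ne', hausdorffMeasure_smul₀ hd hρ.ne', ENNReal.smul_def,
    ENNReal.smul_def]
  simp only [smul_eq_mul]
  rw [ENNReal.mul_inv (.inl ht) (.inl ENNReal.coe_ne_top), mul_mul_mul_comm,
    ENNReal.inv_mul_cancel ht ENNReal.coe_ne_top, one_mul]

lemma isProbabilityMeasure_shell_one {N : ℕ} (hS : sphereArea N ≠ 0) :
    IsProbabilityMeasure (shell N 1) := by
  obtain ⟨h0, htop⟩ := ENNReal.toReal_ne_zero.1 hS
  refine ⟨?_⟩
  rw [shell, Measure.smul_apply, restrict_apply_univ, smul_eq_mul, ENNReal.inv_mul_cancel h0 htop]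

lemma ae_shell_one_norm_eq {N : ℕ} : ∀ᵐ y ∂(shell N 1), ‖y‖ = 1 := by
  refine Measure.ae_smul_measure ?_ _
  filter_upwards [ae_restrict_mem isClosed_sphere.measurableSet] with y hy
  simpa using hy

lemma map_shell_one_linearIsometryEquiv {N : ℕ} (L : Euc N ≃ₗᵢ[ℝ] Euc N) :
    (shell N 1).map L = shell N 1 := by
  ext A hA
  have hpre : L ⁻¹' A ∩ sphere (0 : Euc N) 1 = L ⁻¹' (A ∩ sphere (0 : Euc N) 1) := by
    ext x; simp
  rw [map_apply L.continuous.measurable hA, shell, Measure.smul_apply, Measure.smul_apply,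
    restrict_apply hA, restrict_apply (L.continuous.measurable hA), hpre]
  congr 1
  exact L.toIsometryEquiv.hausdorffMeasure_preimage _ _

/-- The distribution of the distance from a fixed point of the unit sphere to a uniformly
distributed one. -/
def chordMeasure (N : ℕ) (hN : 0 < N) : Measure ℝ :=
  (shell N 1).map fun y => ‖e1 N hN - y‖

lemma map_norm_sub_shell_one {N : ℕ} (hN : 0 < N) {x : Euc N} (hx : ‖x‖ = 1) :
    (shell N 1).map (fun y => ‖x - y‖) = chordMeasure N hN := by
  let L := (ℝ ∙ (x - e1 N hN))ᗮ.reflection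
  have hL : L x = e1 N hN := Submodule.reflection_sub (by rw [hx, norm_e1])
  rw [chordMeasure]
  conv_rhs => rw [← map_shell_one_linearIsometryEquiv L,
    map_map (by fun_prop) L.continuous.measurable]
  congr 1
  ext y
  rw [Function.comp_apply, ← hL, ← map_sub, L.norm_map]

lemma map_norm_sub_prod_shell_one {N : ℕ} (hN : 0 < N) (hS : sphereArea N ≠ 0) :
    ((shell N 1).prod (shell N 1)).map (fun p => ‖p.1 - p.2‖) = chordMeasure N hN := by
  have := isProbabilityMeasure_shell_one hS
  ext A hA
  have hm : Measurable fun p : Euc N × Euc N => ‖p.1 - p.2‖ := by fun_prop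
  rw [map_apply hm hA, prod_apply (hm hA)]
  have h1 : ∀ᵐ x ∂(shell N 1), shell N 1 (Prod.mk x ⁻¹' ((fun p : Euc N × Euc N =>
      ‖p.1 - p.2‖) ⁻¹' A)) = chordMeasure N hN A := by
    filter_upwards [ae_shell_one_norm_eq (N := N)] with x hx
    rw [← map_norm_sub_shell_one hN hx, map_apply (by fun_prop) hA]
    rfl
  rw [lintegral_congr_ae h1]
  simp

lemma isProbabilityMeasure_chordMeasure {N : ℕ} (hN : 0 < N) (hS : sphereArea N ≠ 0) :
    IsProbabilityMeasure (chordMeasure N hN) := by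
  have := isProbabilityMeasure_shell_one hS
  exact isProbabilityMeasure_map (by fun_prop)

lemma exists_hasPowBoundNearZero_chordMeasure {N : ℕ} (hN : 2 ≤ N) (hS : sphereArea N ≠ 0) :
    ∃ δ C, HasPowBoundNearZero (chordMeasure N (two_pos.trans_le hN)) (N - 2) δ C := by
  obtain ⟨δ, hδ, C, hC, h⟩ := exists_lintegral_sphere_inter_ball_le N hN _
    (norm_e1 N (two_pos.trans_le hN))
  obtain ⟨h0, htop⟩ := ENNReal.toReal_ne_zero.1 hS
  refine ⟨δ, (μH[(N : ℝ) - 1] (sphere (0 : Euc N) 1))⁻¹ * C, hδ,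
    ENNReal.mul_ne_top (ENNReal.inv_ne_top.2 h0) hC, ?_, fun g hg => ?_⟩
  · refine (ae_map_iff (by fun_prop) measurableSet_Icc).2 ?_
    filter_upwards [ae_shell_one_norm_eq (N := N)] with y hy
    refine ⟨norm_nonneg _, (norm_sub_le _ _).trans ?_⟩
    rw [hy, norm_e1]; norm_num
  · have hm : Measurable fun y : Euc N => ‖e1 N (two_pos.trans_le hN) - y‖ := by fun_prop
    rw [chordMeasure, setLIntegral_map measurableSet_Iio hg hm, shell, Measure.restrict_smul,
      lintegral_smul_measure, smul_eq_mul, mul_assoc,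
      Measure.restrict_restrict (hm measurableSet_Iio)]
    gcongr
    refine le_of_eq_of_le ?_ (h g hg)
    congr 2
    ext y
    simp [dist_eq_norm, norm_sub_rev, and_comm]

lemma interactionEnergy_shell {N : ℕ} (hN : 0 < N) (hS : sphereArea N ≠ 0) {W : Euc N → ℝ}
    {K : ℝ → ℝ} (hWK : ∀ x, W x = K ‖x‖) (hK : Measurable K) {ρ : ℝ} (hρ : 0 < ρ) :
    interactionEnergy N W (shell N ρ) = 1 / 2 * ∫ x, K (ρ * x) ∂(chordMeasure N hN) := by
  have := isProbabilityMeasure_shell_one hS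
  have hW : W = fun x => K ‖x‖ := funext hWK
  rw [interactionEnergy, ← map_smul_shell N hN hρ, map_prod_map _ _ (by fun_prop) (by fun_prop),
    ← map_norm_sub_prod_shell_one hN hS, integral_map (by fun_prop) (by
      rw [hW]; exact Measurable.aestronglyMeasurable (by fun_prop)),
    integral_map (by fun_prop) (Measurable.aestronglyMeasurable (by fun_prop))]
  congr 1
  refine integral_congr_ae (.of_forall fun p => ?_)
  simp only [Prod.map_fst, Prod.map_snd, hWK]
  rw [← smul_sub, norm_smul, Real.norm_of_nonneg hρ.le]

lemma omegaFun_eq_integral_shell {N : ℕ} (hN : 0 < N) (W : Euc N → ℝ) (r η : ℝ) :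
    omegaFun N hN W r η = -∫ y, ⟪gradient W (r • e1 N hN - η • y), e1 N hN⟫ ∂(shell N 1) := by
  rw [omegaFun, shell, integral_smul_measure, sphereArea, ENNReal.toReal_inv, smul_eq_mul, neg_mul]

lemma inner_gradient_of_radial {E : Type*} [NormedAddCommGroup E] [InnerProductSpace ℝ E]
    [CompleteSpace E] {W : E → ℝ} {K : ℝ → ℝ} (hWK : ∀ x, W x = K ‖x‖) {x : E} (hx : x ≠ 0)
    (hK : DifferentiableAt ℝ K ‖x‖) (v : E) :
    ⟪gradient W x, v⟫ = deriv K ‖x‖ * (⟪x, v⟫ / ‖x‖) := by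
  have hW : W = fun x => K √(‖x‖ ^ 2) := by
    ext x; rw [hWK, Real.sqrt_sq (norm_nonneg _)]
  have hx0 : ‖x‖ ≠ 0 := norm_ne_zero_iff.2 hx
  have hs : √(‖x‖ ^ 2) = ‖x‖ := Real.sqrt_sq (norm_nonneg _)
  have h1 := (hasStrictFDerivAt_norm_sq x).hasFDerivAt.sqrt (pow_ne_zero 2 hx0)
  have h2 : HasDerivAt K (deriv K ‖x‖) √(‖x‖ ^ 2) := hs.symm ▸ hK.hasDerivAt
  have h3 := h2.comp_hasFDerivAt x h1
  rw [show (K ∘ fun y : E => √(‖y‖ ^ 2)) = W from hW.symm] at h3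
  rw [inner_gradient_left, h3.fderiv, hs]
  simp only [_root_.smul_apply, smul_eq_mul, innerSL_apply_apply, nsmul_eq_mul, Nat.cast_ofNat]
  field_simp

section Regularised

variable {K : ℝ → ℝ}

lemma ContDiffOn.differentiableAt_of_ne_zero (hK : ContDiffOn ℝ 1 K {0}ᶜ) {s : ℝ} (hs : s ≠ 0) :
    DifferentiableAt ℝ K s :=
  (hK.differentiableOn one_ne_zero).differentiableAt (isOpen_compl_singleton.mem_nhds hs)

lemma ContDiffOn.continuous_deriv_comp_sqrt {X : Type*} [TopologicalSpace X]
    (hK : ContDiffOn ℝ 1 K {0}ᶜ) {f : X → ℝ} (hf : Continuous f) (hpos : ∀ x, 0 < f x) :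
    Continuous fun x => deriv K √(f x) :=
  (hK.continuousOn_deriv_of_isOpen isOpen_compl_singleton le_rfl).comp_continuous
    (by fun_prop) fun x => (Real.sqrt_pos.2 (hpos x)).ne'

lemma omegaFun_eq_integral_chordMeasure {N : ℕ} (hN : 0 < N) {W : Euc N → ℝ}
    (hWK : ∀ x, W x = K ‖x‖) (hK : ContDiffOn ℝ 1 K {0}ᶜ) {r η : ℝ} (hr : 0 < r) (hη : 0 < η)
    (hne : r ≠ η) :
    omegaFun N hN W r η = -∫ x, deriv K √((r - η) ^ 2 + r * η * x ^ 2) *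
      ((r - η * (1 - x ^ 2 / 2)) / √((r - η) ^ 2 + r * η * x ^ 2)) ∂(chordMeasure N hN) := by
  have hpos : ∀ x : ℝ, 0 < (r - η) ^ 2 + r * η * x ^ 2 := fun x => by
    have := sub_ne_zero.2 hne
    positivity
  have hc : Continuous fun x : ℝ => deriv K √((r - η) ^ 2 + r * η * x ^ 2) *
      ((r - η * (1 - x ^ 2 / 2)) / √((r - η) ^ 2 + r * η * x ^ 2)) :=
    (hK.continuous_deriv_comp_sqrt (by fun_prop) hpos).mul
      (Continuous.div (by fun_prop) (by fun_prop) fun x => (Real.sqrt_pos.2 (hpos x)).ne')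
  rw [omegaFun_eq_integral_shell, chordMeasure,
    integral_map (by fun_prop) hc.aestronglyMeasurable]
  congr 1
  refine integral_congr_ae ?_
  filter_upwards [ae_shell_one_norm_eq] with y hy
  have he := norm_e1 N hN
  have hin : ⟪e1 N hN, y⟫ = 1 - ‖e1 N hN - y‖ ^ 2 / 2 := by
    rw [norm_sub_sq_real, hy, he]; ring
  have hnorm : √((r - η) ^ 2 + r * η * ‖e1 N hN - y‖ ^ 2) = ‖r • e1 N hN - η • y‖ := by
    rw [← Real.sqrt_sq (norm_nonneg (r • e1 N hN - η • y))]
    congr 1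
    rw [norm_sub_sq_real (r • e1 N hN), inner_smul_left, inner_smul_right, norm_smul, norm_smul,
      hin, hy, he, Real.norm_of_nonneg hr.le, Real.norm_of_nonneg hη.le]
    simp
    ring
  have h0 : 0 < ‖r • e1 N hN - η • y‖ := hnorm ▸ Real.sqrt_pos.2 (hpos _)
  rw [inner_gradient_of_radial hWK (norm_pos_iff.1 h0) (hK.differentiableAt_of_ne_zero h0.ne'),
    hnorm, inner_sub_left, inner_smul_left, inner_smul_left,
    real_inner_comm (e1 N hN) y, hin]
  simp [he]

lemma omegaFun_add_omegaFun_swap {N : ℕ} (hN : 2 ≤ N) (hS : sphereArea N ≠ 0) {W : Euc N → ℝ}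
    (hWK : ∀ x, W x = K ‖x‖) (hK : ContDiffOn ℝ 1 K {0}ᶜ) {r η : ℝ} (hr : 0 < r) (hη : 0 < η)
    (hne : r ≠ η) :
    omegaFun N (two_pos.trans_le hN) W r η + omegaFun N (two_pos.trans_le hN) W η r =
      -((r + η) / 2 * ∫ x, deriv K √((r - η) ^ 2 + r * η * x ^ 2) *
        (x ^ 2 / √((r - η) ^ 2 + r * η * x ^ 2)) ∂(chordMeasure N (two_pos.trans_le hN))) := by
  have := isProbabilityMeasure_chordMeasure (N := N) (two_pos.trans_le hN) hS
  obtain ⟨δ, C, hμ⟩ := exists_hasPowBoundNearZero_chordMeasure hN hS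
  have hpos : ∀ x : ℝ, 0 < (r - η) ^ 2 + r * η * x ^ 2 := fun x => by
    have := sub_ne_zero.2 hne
    positivity
  have hc : ∀ a b : ℝ, Integrable (fun x : ℝ => deriv K √((r - η) ^ 2 + r * η * x ^ 2) *
      ((a - b * (1 - x ^ 2 / 2)) / √((r - η) ^ 2 + r * η * x ^ 2)))
      (chordMeasure N (two_pos.trans_le hN)) :=
    fun a b => integrable_of_continuous_of_ae_mem_Icc hμ.ae_mem <|
      (hK.continuous_deriv_comp_sqrt (by fun_prop) hpos).mul
        (Continuous.div (by fun_prop) (by fun_prop) fun x => (Real.sqrt_pos.2 (hpos x)).ne')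
  have hsymm : ∀ x : ℝ, (η - r) ^ 2 + η * r * x ^ 2 = (r - η) ^ 2 + r * η * x ^ 2 := fun x => by
    ring
  rw [omegaFun_eq_integral_chordMeasure _ hWK hK hr hη hne,
    omegaFun_eq_integral_chordMeasure _ hWK hK hη hr hne.symm]
  simp only [hsymm]
  rw [← neg_add, ← integral_add (hc r η) (hc η r), ← integral_const_mul]
  congr 1
  refine integral_congr_ae (.of_forall fun x => ?_)
  ring

lemma hasDerivAt_integral_comp_sqrt {μ : Measure ℝ} [IsFiniteMeasure μ]
    (hμ : ∀ᵐ x ∂μ, x ∈ Icc (0 : ℝ) 2) (hK : ContDiffOn ℝ 1 K {0}ᶜ) {d : ℝ} (hd : d ≠ 0) (ρ : ℝ) :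
    HasDerivAt (fun ρ => ∫ x, K √(d ^ 2 + (ρ * x) ^ 2) ∂μ)
      (ρ * ∫ x, deriv K √(d ^ 2 + (ρ * x) ^ 2) * (x ^ 2 / √(d ^ 2 + (ρ * x) ^ 2)) ∂μ) ρ := by
  have hpos : ∀ ρ x : ℝ, 0 < d ^ 2 + (ρ * x) ^ 2 := fun ρ x => by positivity
  have hKc : ∀ ρ, Continuous fun x : ℝ => K √(d ^ 2 + (ρ * x) ^ 2) := fun ρ =>
    hK.continuousOn.comp_continuous (by fun_prop) fun x => (Real.sqrt_pos.2 (hpos ρ x)).ne'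
  let G : ℝ × ℝ → ℝ := fun p => deriv K √(d ^ 2 + (p.1 * p.2) ^ 2) *
    (p.1 * p.2 ^ 2 / √(d ^ 2 + (p.1 * p.2) ^ 2))
  have hG : Continuous G :=
    (hK.continuous_deriv_comp_sqrt (by fun_prop) fun p : ℝ × ℝ => hpos p.1 p.2).mul
      (Continuous.div (by fun_prop) (by fun_prop) fun p : ℝ × ℝ =>
        (Real.sqrt_pos.2 (hpos p.1 p.2)).ne')
  obtain ⟨M, hM⟩ := (isCompact_Icc.prod isCompact_Icc).exists_bound_of_continuousOn
    (hG.continuousOn (s := Icc (ρ - 1) (ρ + 1) ×ˢ Icc (0 : ℝ) 2))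
  have key := (hasDerivAt_integral_of_dominated_loc_of_deriv_le (μ := μ) (x₀ := ρ)
    (F := fun ρ x => K √(d ^ 2 + (ρ * x) ^ 2)) (F' := fun ρ x => G (ρ, x)) (bound := fun _ => M)
    (Icc_mem_nhds (sub_one_lt ρ) (lt_add_one ρ))
    (.of_forall fun ρ => (hKc ρ).aestronglyMeasurable)
    (integrable_of_continuous_of_ae_mem_Icc hμ (hKc ρ))
    (Continuous.aestronglyMeasurable (by fun_prop))
    (hμ.mono fun x hx ρ' hρ' => hM (ρ', x) ⟨hρ', hx⟩) (integrable_const _)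
    (.of_forall fun x ρ' _ => ?_)).2
  · refine key.congr_deriv ?_
    rw [← integral_const_mul]
    refine integral_congr_ae (.of_forall fun x => ?_)
    simp only [G]
    ring
  · have h1 : HasDerivAt (fun ρ : ℝ => d ^ 2 + (ρ * x) ^ 2) (2 * (ρ' * x) * x) ρ' := by
      have := (((hasDerivAt_id ρ').mul_const x).pow 2).const_add (d ^ 2)
      simpa using this
    have h2 := h1.sqrt (hpos ρ' x).ne'
    have h3 := (hK.differentiableAt_of_ne_zero
      (Real.sqrt_pos.2 (hpos ρ' x)).ne').hasDerivAt.comp ρ' h2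
    refine h3.congr_deriv ?_
    simp only [G]
    have := (Real.sqrt_pos.2 (hpos ρ' x)).ne'
    field_simp

end Regularised

lemma exists_mul_sq_le_mul_sub_of_hasDerivAt {h : ℝ → ℝ} {R c : ℝ} (hR : h R = 0)
    (hc : 0 < c) (hd : HasDerivAt h c R) :
    ∃ ε > 0, ∀ ρ, |ρ - R| < ε → c / 2 * (ρ - R) ^ 2 ≤ h ρ * (ρ - R) := by
  have h1 := (hasDerivAt_iff_isLittleO.1 hd).bound (half_pos hc)
  obtain ⟨ε, hε, hball⟩ := Metric.eventually_nhds_iff.1 h1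
  refine ⟨ε, hε, fun ρ hρ => ?_⟩
  have h2 := hball (y := ρ) (by rwa [Real.dist_eq])
  simp only [hR, sub_zero, smul_eq_mul, Real.norm_eq_abs] at h2
  have h3 : |(h ρ - (ρ - R) * c) * (ρ - R)| ≤ c / 2 * (ρ - R) ^ 2 := by
    rw [abs_mul, ← sq_abs (ρ - R)]
    nlinarith [abs_nonneg (ρ - R)]
  nlinarith [(abs_le.1 h3).1]

/-- A function whose derivative is close to `-2 h`, where `h` vanishes at `R` and grows at least
linearly there, decreases away from `R`. -/
lemma sub_le_of_hasDerivAt_of_abs_sub_le {P F h : ℝ → ℝ} {R s c c' : ℝ}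
    (hP : ∀ ρ ∈ uIcc R (R + s), HasDerivAt P (-F ρ) ρ)
    (hF : ∀ ρ ∈ uIcc R (R + s), |F ρ - 2 * h ρ| ≤ c')
    (hh : ∀ ρ ∈ uIcc R (R + s), c / 2 * (ρ - R) ^ 2 ≤ h ρ * (ρ - R)) :
    P (R + s) - P R ≤ c' * |s| - c / 2 * s ^ 2 := by
  have hmem : ∀ t ∈ Icc (0 : ℝ) 1, R + t * s ∈ uIcc R (R + s) := by
    intro t ht
    rcases le_total 0 s with hs | hs
    · rw [uIcc_of_le (by linarith)]
      constructor <;> nlinarith [ht.1, ht.2]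
    · rw [uIcc_of_ge (by linarith)]
      constructor <;> nlinarith [ht.1, ht.2]
  have hQ : ∀ t ∈ Icc (0 : ℝ) 1, HasDerivAt
      (fun t => P (R + t * s) + c / 2 * s ^ 2 * t ^ 2 - c' * |s| * t)
      (-F (R + t * s) * s + c * s ^ 2 * t - c' * |s|) t := by
    intro t ht
    have h1 : HasDerivAt (fun t : ℝ => R + t * s) s t := by
      simpa using ((hasDerivAt_id t).mul_const s).const_add R
    have h2 := (hP _ (hmem t ht)).comp t h1
    have h3 := ((hasDerivAt_id t).pow 2).const_mul (c / 2 * s ^ 2)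
    have h4 := (hasDerivAt_id t).const_mul (c' * |s|)
    refine ((h2.add h3).sub h4).congr_deriv ?_
    simp
    ring
  have hanti : AntitoneOn (fun t => P (R + t * s) + c / 2 * s ^ 2 * t ^ 2 - c' * |s| * t)
      (Icc (0 : ℝ) 1) := by
    refine antitoneOn_of_deriv_nonpos (convex_Icc 0 1)
      (fun t ht => (hQ t ht).continuousAt.continuousWithinAt)
      (fun t ht => (hQ t (interior_subset ht)).differentiableAt.differentiableWithinAt) ?_
    intro t ht
    rw [(hQ t (interior_subset ht)).deriv]
    rw [interior_Icc] at ht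
    have hm := hmem t (Ioo_subset_Icc_self ht)
    have h1 : c / 2 * s ^ 2 * t ≤ h (R + t * s) * s := by
      have := hh _ hm
      rw [add_sub_cancel_left] at this
      refine le_of_mul_le_mul_right ?_ ht.1
      linarith
    have h2 : |(F (R + t * s) - 2 * h (R + t * s)) * s| ≤ c' * |s| := by
      rw [abs_mul]
      gcongr
      exact hF _ hm
    linarith [(abs_le.1 h2).1]
  have := hanti (left_mem_Icc.2 zero_le_one) (right_mem_Icc.2 zero_le_one) zero_le_one
  simp only [one_mul, zero_mul, add_zero] at this
  linarith

/-- The derivative in the radius of the regularised energy, in terms of `ω` at the two radii with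
geometric mean `ρ` that differ by `d`. -/
lemma hasDerivAt_regularised_energy {N : ℕ} (hN : 2 ≤ N) (hS : sphereArea N ≠ 0) {W : Euc N → ℝ}
    {K : ℝ → ℝ} (hWK : ∀ x, W x = K ‖x‖) (hK : ContDiffOn ℝ 1 K {0}ᶜ) {d ρ : ℝ} (hd : 0 < d)
    (hρ : 0 < ρ) :
    HasDerivAt (fun ρ => ∫ x, K √(d ^ 2 + (ρ * x) ^ 2) ∂(chordMeasure N (two_pos.trans_le hN)))
      (-(ρ / √(ρ ^ 2 + d ^ 2 / 4) *
        (omegaFun N (two_pos.trans_le hN) W (√(ρ ^ 2 + d ^ 2 / 4) + d / 2)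
          (√(ρ ^ 2 + d ^ 2 / 4) - d / 2) +
        omegaFun N (two_pos.trans_le hN) W (√(ρ ^ 2 + d ^ 2 / 4) - d / 2)
          (√(ρ ^ 2 + d ^ 2 / 4) + d / 2)))) ρ
    := by
  have := isProbabilityMeasure_chordMeasure (N := N) (two_pos.trans_le hN) hS
  obtain ⟨δ, C, hμ⟩ := exists_hasPowBoundNearZero_chordMeasure hN hS
  set m := √(ρ ^ 2 + d ^ 2 / 4) with hm
  have hm2 : m ^ 2 = ρ ^ 2 + d ^ 2 / 4 := Real.sq_sqrt (by positivity)
  have hmd : d / 2 < m := Real.lt_sqrt_of_sq_lt (by nlinarith)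
  have hm0 : 0 < m := by linarith
  have h1 : (m + d / 2 - (m - d / 2)) ^ 2 = d ^ 2 := by ring
  have h2 : (m + d / 2) * (m - d / 2) = ρ ^ 2 := by linarith [hm2]
  rw [omegaFun_add_omegaFun_swap hN hS hWK hK (by linarith) (by linarith) (by linarith)]
  refine (hasDerivAt_integral_comp_sqrt hμ.ae_mem hK hd.ne' ρ).congr_deriv ?_
  simp only [h1, h2, mul_pow]
  field_simp
  ring

/-- Proposition 2.5(ii): if the shifting stability condition (C2) fails, i.e.
∂₁ω(R,R) + ∂₂ω(R,R) > 0, then slightly increasing or decreasing the radius of the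
spherical shell decreases the energy. -/
theorem shift_instability_energy (N : ℕ) (hN : 2 ≤ N) (W : Euc N → ℝ) (k : ℝ → ℝ)
    (hrad : ∀ x, W x = k ‖x‖)
    (hW : ContDiffOn ℝ 1 W {(0 : Euc N)}ᶜ)
    (hk : LocIntOnHyp N k)
    (hω : ContDiffOn ℝ 1 (fun p : ℝ × ℝ => omegaFun N (by omega) W p.1 p.2)
      (Ioi (0:ℝ) ×ˢ Ioi (0:ℝ)))
    (R : ℝ) (hR : 0 < R)
    (hC0 : omegaFun N (by omega) W R R = 0)
    (hC2fail : 0 < deriv (fun r => omegaFun N (by omega) W r R) R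
        + deriv (fun η => omegaFun N (by omega) W R η) R) :
    ∃ dr₀ > 0, dr₀ < R ∧ ∀ dr : ℝ, 0 < |dr| → |dr| < dr₀ →
      interactionEnergy N W (shell N (R + dr)) < interactionEnergy N W (shell N R) := by
  have hN0 : 0 < N := by omega
  have hS : sphereArea N ≠ 0 := by
    intro h
    simp [omegaFun, h] at hC2fail
  have hprob := isProbabilityMeasure_chordMeasure hN0 hS
  obtain ⟨δ, C, hμ⟩ := exists_hasPowBoundNearZero_chordMeasure hN hS
  -- the profile of `W`
  let K : ℝ → ℝ := fun s => W (s • e1 N hN0)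
  have hKk : ∀ s, 0 ≤ s → K s = k s := fun s hs => by
    simp [K, hrad, norm_smul, norm_e1, abs_of_nonneg hs]
  have hWK : ∀ x, W x = K ‖x‖ := fun x => by rw [hKk _ (norm_nonneg _), hrad]
  have hK : ContDiffOn ℝ 1 K {0}ᶜ := by
    refine hW.comp (ContDiff.contDiffOn (by fun_prop)) fun s hs => ?_
    have : e1 N hN0 ≠ 0 := norm_ne_zero_iff.1 (by rw [norm_e1]; exact one_ne_zero)
    simpa [this] using hs
  have hKint : IntegrableOn (fun r => |K r| * r ^ (N - 2)) (Ioo (0 : ℝ) 1) :=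
    hk.congr_fun (fun s hs => by simp only [hKk s hs.1.le]) measurableSet_Ioo
  have hKm : Measurable K := measurable_of_continuousOn_compl_singleton 0 hK.continuousOn
  -- `ω` along the diagonal
  let Ω : ℝ × ℝ → ℝ := fun p => omegaFun N hN0 W p.1 p.2
  have hopen : IsOpen (Ioi (0 : ℝ) ×ˢ Ioi (0 : ℝ)) := isOpen_Ioi.prod isOpen_Ioi
  have hΩc : ∀ a b : ℝ, 0 < a → 0 < b → ContinuousAt Ω (a, b) := fun a b ha hb =>
    hω.continuousOn.continuousAt (hopen.mem_nhds ⟨ha, hb⟩)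
  have hΩd : DifferentiableAt ℝ Ω (R, R) :=
    (hω.differentiableOn one_ne_zero).differentiableAt (hopen.mem_nhds ⟨hR, hR⟩)
  set c := deriv (fun r => omegaFun N hN0 W r R) R + deriv (fun η => omegaFun N hN0 W R η) R
    with hc
  have hdiag : HasDerivAt (fun ρ => Ω (ρ, ρ)) c R := by
    have h1 : HasDerivAt (fun r => Ω (r, R)) (fderiv ℝ Ω (R, R) (1, 0)) R :=
      hΩd.hasFDerivAt.comp_hasDerivAt (f := fun r => (r, R)) R
        ((hasDerivAt_id R).prodMk (hasDerivAt_const R R))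
    have h2 : HasDerivAt (fun η => Ω (R, η)) (fderiv ℝ Ω (R, R) (0, 1)) R :=
      hΩd.hasFDerivAt.comp_hasDerivAt (f := fun η => (R, η)) R
        ((hasDerivAt_const R R).prodMk (hasDerivAt_id R))
    have h3 : HasDerivAt (fun ρ => Ω (ρ, ρ)) (fderiv ℝ Ω (R, R) (1, 1)) R :=
      hΩd.hasFDerivAt.comp_hasDerivAt (f := fun ρ => (ρ, ρ)) R
        ((hasDerivAt_id R).prodMk (hasDerivAt_id R))
    have hsum : c = fderiv ℝ Ω (R, R) (1, 1) := by
      rw [hc, h1.deriv, h2.deriv, ← map_add]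
      simp
    rwa [hsum]
  obtain ⟨ε, hε, hlin⟩ := exists_mul_sq_le_mul_sub_of_hasDerivAt
    (h := fun ρ => Ω (ρ, ρ)) hC0 hC2fail hdiag
  refine ⟨min ε (R / 2), lt_min hε (half_pos hR), (min_le_right _ _).trans_lt (half_lt_self hR),
    fun dr hdr0 hdr => ?_⟩
  have hdrε : |dr| < ε := hdr.trans_le (min_le_left _ _)
  have hdrR : |dr| < R / 2 := hdr.trans_le (min_le_right _ _)
  have hRdr : 0 < R + dr := by linarith [neg_abs_le dr]
  have hI : ∀ ρ ∈ uIcc R (R + dr), 0 < ρ ∧ |ρ - R| < ε := fun ρ hρ => by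
    have h1 := abs_sub_left_of_mem_uIcc hρ
    rw [add_sub_cancel_left] at h1
    exact ⟨(lt_min hR hRdr).trans_le hρ.1, h1.trans_lt hdrε⟩
  let m : ℝ × ℝ → ℝ := fun p => √(p.2 ^ 2 + p.1 ^ 2 / 4)
  let F : ℝ × ℝ → ℝ := fun p => p.2 / m p *
    (Ω (m p + p.1 / 2, m p - p.1 / 2) + Ω (m p - p.1 / 2, m p + p.1 / 2))
  have hm0 : ∀ ρ, 0 < ρ → m (0, ρ) = ρ := fun ρ hρ => by simp [m, Real.sqrt_sq hρ.le]
  have hF0 : ∀ ρ, 0 < ρ → F (0, ρ) = 2 * Ω (ρ, ρ) := fun ρ hρ => by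
    simp only [F, hm0 ρ hρ, div_self hρ.ne']
    simp
    ring
  have hmc : Continuous m := by fun_prop
  have hFc : ∀ ρ, 0 < ρ → ContinuousAt F (0, ρ) := fun ρ hρ => by
    have h1 : ContinuousAt (fun p : ℝ × ℝ => Ω (m p + p.1 / 2, m p - p.1 / 2)) (0, ρ) := by
      refine ContinuousAt.comp (g := Ω) (f := fun p : ℝ × ℝ => (m p + p.1 / 2, m p - p.1 / 2)) ?_
        (Continuous.continuousAt (by fun_prop))
      refine hΩc _ _ ?_ ?_ <;> simpa [hm0 ρ hρ] using hρ
    have h2 : ContinuousAt (fun p : ℝ × ℝ => Ω (m p - p.1 / 2, m p + p.1 / 2)) (0, ρ) := by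
      refine ContinuousAt.comp (g := Ω) (f := fun p : ℝ × ℝ => (m p - p.1 / 2, m p + p.1 / 2)) ?_
        (Continuous.continuousAt (by fun_prop))
      refine hΩc _ _ ?_ ?_ <;> simpa [hm0 ρ hρ] using hρ
    exact (continuousAt_snd.div hmc.continuousAt (by rw [hm0 ρ hρ]; exact hρ.ne')).mul (h1.add h2)
  have hc' : 0 < c / 4 * |dr| := by positivity
  have hunif : ∀ᶠ d in 𝓝 (0 : ℝ), ∀ ρ ∈ uIcc R (R + dr),
      |F (d, ρ) - 2 * Ω (ρ, ρ)| < c / 4 * |dr| := by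
    refine isCompact_uIcc.eventually_forall_of_forall_eventually fun ρ hρ => ?_
    have hρ0 := (hI ρ hρ).1
    have h1 : ContinuousAt (fun p : ℝ × ℝ => |F p - 2 * Ω (p.2, p.2)|) (0, ρ) := by
      refine ((hFc ρ hρ0).sub (continuousAt_const.mul ?_)).abs
      exact ContinuousAt.comp (g := Ω) (f := fun p : ℝ × ℝ => (p.2, p.2)) (hΩc ρ ρ hρ0 hρ0)
        (Continuous.continuousAt (by fun_prop))
    refine h1.eventually_lt_const ?_
    show |F (0, ρ) - 2 * Ω (ρ, ρ)| < _
    rw [hF0 ρ hρ0, sub_self, abs_zero]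
    exact hc'
  have hle := hμ.integral_sub_integral_le hK.continuousOn hKint hR hRdr
    (a := c / 4 * |dr| * |dr| - c / 2 * dr ^ 2) (by
      filter_upwards [nhdsWithin_le_nhds hunif, self_mem_nhdsWithin] with d hd hd0
      exact sub_le_of_hasDerivAt_of_abs_sub_le (F := fun ρ => F (d, ρ)) (h := fun ρ => Ω (ρ, ρ))
        (P := fun ρ => ∫ x, K √(d ^ 2 + (ρ * x) ^ 2) ∂(chordMeasure N hN0))
        (fun ρ hρ => hasDerivAt_regularised_energy hN hS hWK hK hd0 (hI ρ hρ).1)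
        (fun ρ hρ => (hd ρ hρ).le) (fun ρ hρ => hlin ρ (hI ρ hρ).2))
  rw [interactionEnergy_shell hN0 hS hWK hKm hRdr, interactionEnergy_shell hN0 hS hWK hKm hR]
  have hsq : |dr| * |dr| = dr ^ 2 := by rw [← sq, sq_abs]
  have hpos : 0 < c * dr ^ 2 := by rw [← hsq]; positivity
  rw [mul_assoc, hsq] at hle
  linarith
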